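/- arXiv:2107.10594 — 2 statements merged into one kernel-verified Lean document; each statement's English description precedes it below -/
import Mathlib

section
/- Let α be real with |α| > 1 and let z : ℤ → ℂ be rapidly decaying. Then (1/4) Re Σ_β [ (S(β−1) z(β−1) + S(β+1) z(β+1)) / S(β) ] · conj( z(β−1) + z(β+1) ) ≥ −(1/8) Σ_β S(β) |z(β−1) − z(β+1)|². -/
/-- `S(β) = (α² + β²)^{1/2}`. -/
noncomputable def Sv (α : ℝ) (β : ℤ) : ℝ := Real.sqrt (α ^ 2 + (β : ℝ) ^ 2)

/-- A sequence `z : ℤ → ℂ` is rapidly decaying if `Σ_β (1+β²)^k |z(β)|² < ∞` for all `k`. -/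
def RapidlyDecayingSeq (z : ℤ → ℂ) : Prop :=
  ∀ k : ℕ, Summable (fun β : ℤ => (1 + (β : ℝ) ^ 2) ^ k * ‖z β‖ ^ 2)

theorem Sv_one_le (α : ℝ) (hα : 1 < |α|) (β : ℤ) : 1 ≤ Sv α β := by
  unfold Sv
  apply Real.le_sqrt_of_sq_le
  have : 1 < α ^ 2 := by rw [← sq_abs]; nlinarith
  nlinarith [sq_nonneg (β : ℝ)]

theorem Sv_succ_le (α : ℝ) (β γ : ℤ) (h : |(β : ℝ) - γ| ≤ 1) : Sv α β ≤ Sv α γ + 1 := by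
  unfold Sv
  have h0 := Real.sqrt_nonneg (α ^ 2 + (γ : ℝ) ^ 2)
  have h1 := Real.sq_sqrt (show 0 ≤ α ^ 2 + (γ : ℝ) ^ 2 by positivity)
  have h2 : |(γ : ℝ)| ≤ √(α ^ 2 + (γ : ℝ) ^ 2) :=
    Real.abs_le_sqrt (by nlinarith [sq_nonneg α])
  apply Real.sqrt_le_iff.2 ⟨by linarith, ?_⟩
  have h3 : (β : ℝ) ^ 2 ≤ (|(γ : ℝ)| + 1) ^ 2 := by
    rw [← sq_abs (β : ℝ)]
    have : |(β : ℝ)| ≤ |(γ : ℝ)| + 1 := by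
      have := abs_sub_abs_le_abs_sub (β : ℝ) γ
      linarith
    gcongr
  nlinarith [sq_abs (γ : ℝ)]

theorem Sv_le (α : ℝ) (hα : 1 < |α|) (β : ℤ) : Sv α β ≤ |α| * (1 + (β : ℝ) ^ 2) := by
  unfold Sv
  apply Real.sqrt_le_iff.2 ⟨by positivity, ?_⟩
  have : 1 < α ^ 2 := by rw [← sq_abs]; nlinarith
  rw [mul_pow, sq_abs]
  have hb := sq_nonneg (β : ℝ)
  have h1 : (1 + (β : ℝ) ^ 2) ≤ (1 + (β : ℝ) ^ 2) ^ 2 := by nlinarith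
  nlinarith

theorem real_form (p q s a b : ℝ) (hp : 1 ≤ p) (hq : 1 ≤ q) (hs : 1 ≤ s)
    (h1 : p - q ≤ 2) (h2 : q - p ≤ 2) :
    0 ≤ (p * a + q * b) * (a + b) / s + s / 2 * (a - b) ^ 2 := by
  have hs0 : 0 < s := by linarith
  have key : 0 ≤ (p * a + q * b) * (a + b) + s ^ 2 / 2 * (a - b) ^ 2 := by
    have e : (p * a + q * b) * (a + b) = (p + q) / 2 * (a + b) ^ 2
        + (p - q) / 2 * ((a + b) * (a - b)) := by ring
    rw [e]
    generalize a + b = u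
    generalize a - b = v
    have k1 : u ^ 2 ≤ (p + q) / 2 * u ^ 2 := by nlinarith [sq_nonneg u]
    have k2 : v ^ 2 ≤ s ^ 2 * v ^ 2 := le_mul_of_one_le_left (sq_nonneg v) (by nlinarith)
    have k3 : ((p - q) / 2) ^ 2 ≤ 1 := by nlinarith
    have k4 : ((p - q) / 2) ^ 2 * u ^ 2 ≤ u ^ 2 := by nlinarith [sq_nonneg u]
    nlinarith [sq_nonneg ((p - q) / 2 * u + v), sq_nonneg ((p - q) / 2 * u + v / 2)]
  have : (p * a + q * b) * (a + b) / s + s / 2 * (a - b) ^ 2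
      = ((p * a + q * b) * (a + b) + s ^ 2 / 2 * (a - b) ^ 2) / s := by
    field_simp
  rw [this]
  positivity

theorem complex_form (p q s : ℝ) (a b : ℂ) (hp : 1 ≤ p) (hq : 1 ≤ q) (hs : 1 ≤ s)
    (h1 : p - q ≤ 2) (h2 : q - p ≤ 2) :
    0 ≤ (((p : ℂ) * a + (q : ℂ) * b) / (s : ℂ) * (starRingEnd ℂ) (a + b)).re
      + 1 / 2 * (s * ‖a - b‖ ^ 2) := by
  have r1 := real_form p q s a.re b.re hp hq hs h1 h2
  have r2 := real_form p q s a.im b.im hp hq hs h1 h2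
  rw [Complex.sq_norm, Complex.normSq_apply]
  have : (((p : ℂ) * a + (q : ℂ) * b) / (s : ℂ) * (starRingEnd ℂ) (a + b)).re
      = (p * a.re + q * b.re) * (a.re + b.re) / s
        + (p * a.im + q * b.im) * (a.im + b.im) / s := by
    simp [Complex.mul_re, Complex.div_ofReal_re, Complex.div_ofReal_im]
    ring
  rw [this]
  simp only [Complex.sub_re, Complex.sub_im]
  linarith

theorem complex_bound (p q s : ℝ) (a b : ℂ) (hp : 1 ≤ p) (hq : 1 ≤ q) (hs : 1 ≤ s)
    (h1 : p ≤ s + 1) (h2 : q ≤ s + 1) :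
    ‖((p : ℂ) * a + (q : ℂ) * b) / (s : ℂ) * (starRingEnd ℂ) (a + b)‖
      ≤ 4 * (‖a‖ ^ 2 + ‖b‖ ^ 2) := by
  have hs0 : 0 < s := by linarith
  rw [norm_mul, norm_div, RCLike.norm_conj, Complex.norm_real, Real.norm_of_nonneg hs0.le]
  have n1 : ‖(p : ℂ) * a + (q : ℂ) * b‖ ≤ 2 * s * (‖a‖ + ‖b‖) := by
    refine (norm_add_le _ _).trans ?_
    rw [norm_mul, norm_mul, Complex.norm_real, Complex.norm_real,
      Real.norm_of_nonneg (by linarith), Real.norm_of_nonneg (by linarith)]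
    nlinarith [norm_nonneg a, norm_nonneg b]
  have n2 : ‖(p : ℂ) * a + (q : ℂ) * b‖ / s ≤ 2 * (‖a‖ + ‖b‖) := by
    rw [div_le_iff₀ hs0]; linarith
  calc _ ≤ 2 * (‖a‖ + ‖b‖) * (‖a‖ + ‖b‖) := by
        gcongr
        exact norm_add_le _ _
    _ ≤ _ := by nlinarith [sq_nonneg (‖a‖ - ‖b‖)]

theorem B_positivity (α : ℝ) (hα : 1 < |α|) (z : ℤ → ℂ) (hz : RapidlyDecayingSeq z) :
    (1 / 4) * (∑' β : ℤ,
        ((((Sv α (β - 1) : ℝ) : ℂ) * z (β - 1) + ((Sv α (β + 1) : ℝ) : ℂ) * z (β + 1)) /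
            ((Sv α β : ℝ) : ℂ)) * (starRingEnd ℂ) (z (β - 1) + z (β + 1))).re
      ≥ -(1 / 8) * ∑' β : ℤ, Sv α β * ‖z (β - 1) - z (β + 1)‖ ^ 2 := by
  have L := Sv_one_le α hα
  have A1 : ∀ β : ℤ, Sv α (β - 1) ≤ Sv α β + 1 := fun β => Sv_succ_le _ _ _ (by simp)
  have A2 : ∀ β : ℤ, Sv α (β + 1) ≤ Sv α β + 1 := fun β => Sv_succ_le _ _ _ (by simp)
  have A3 : ∀ β : ℤ, Sv α β ≤ Sv α (β - 1) + 1 := fun β => Sv_succ_le _ _ _ (by simp)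
  have A4 : ∀ β : ℤ, Sv α β ≤ Sv α (β + 1) + 1 := fun β => Sv_succ_le _ _ _ (by simp)
  have Z0 : Summable (fun β : ℤ => ‖z β‖ ^ 2) := by simpa using hz 0
  have Z1 : Summable (fun β : ℤ => Sv α β * ‖z β‖ ^ 2) := by
    refine Summable.of_nonneg_of_le (fun β => ?_) (fun β => ?_) ((hz 1).mul_left |α|)
    · have := L β
      positivity
    · rw [pow_one, ← mul_assoc]
      gcongr
      exact Sv_le α hα β
  have sh : ∀ f : ℤ → ℝ, Summable f →
      Summable (fun β => f (β - 1)) ∧ Summable (fun β => f (β + 1)) := fun f hf =>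
    ⟨(Equiv.subRight (1 : ℤ)).summable_iff.2 hf, (Equiv.addRight (1 : ℤ)).summable_iff.2 hf⟩
  have S2 : Summable (fun β : ℤ => Sv α β * ‖z (β - 1) - z (β + 1)‖ ^ 2) := by
    refine Summable.of_nonneg_of_le (fun β => ?_) (fun β => ?_)
      (((sh _ Z1).1.add (sh _ Z1).2).mul_left 4)
    · have := L β
      positivity
    · have hs := L β
      have hp := L (β - 1)
      have hq := L (β + 1)
      have h3 := A3 β
      have h4 := A4 β
      have n := norm_sub_le (z (β - 1)) (z (β + 1))
      have n2 : ‖z (β - 1) - z (β + 1)‖ ^ 2 ≤ 2 * ‖z (β - 1)‖ ^ 2 + 2 * ‖z (β + 1)‖ ^ 2 := by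
        have := norm_nonneg (z (β - 1) - z (β + 1))
        nlinarith [sq_nonneg (‖z (β - 1)‖ - ‖z (β + 1)‖)]
      have m0 := mul_le_mul_of_nonneg_left n2 (show 0 ≤ Sv α β by linarith)
      have m1 := mul_le_mul_of_nonneg_right (show Sv α β ≤ 2 * Sv α (β - 1) by linarith)
        (sq_nonneg ‖z (β - 1)‖)
      have m2 := mul_le_mul_of_nonneg_right (show Sv α β ≤ 2 * Sv α (β + 1) by linarith)
        (sq_nonneg ‖z (β + 1)‖)
      linarith
  have S1 := Summable.of_norm_bounded (((sh _ Z0).1.add (sh _ Z0).2).mul_left 4)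
    (fun β => complex_bound _ _ _ (z (β - 1)) (z (β + 1)) (L (β - 1)) (L (β + 1)) (L β)
      (A1 β) (A2 β))
  have S1r := (Complex.hasSum_re S1.hasSum).summable
  rw [Complex.re_tsum S1]
  have key := tsum_nonneg (L := .unconditional ℤ) (fun β => complex_form _ _ _ (z (β - 1)) (z (β + 1))
    (L (β - 1)) (L (β + 1)) (L β)
    (by linarith [A1 β, A4 β])
    (by linarith [A2 β, A3 β]))
  rw [Summable.tsum_add S1r (S2.mul_left _), tsum_mul_left] at key
  linarith
end

section
/- Let α be real with |α| > 1 and let z : ℤ → ℂ be rapidly decaying. Then −(1/4) Re Σ_β ( S(β−1)² z(β−1) − S(β+1)² z(β+1) ) · conj( z(β−1) − z(β+1) ) − (1/4) Re Σ_β [ ( S(β−1)² z(β−1) + S(β+1)² z(β+1) ) / S(β) ] · conj( z(β−1) + z(β+1) ) ≤ −(α²/4) Σ_β |z(β−1) − z(β+1)|² − (1/4) Σ_β |(β−1) z(β−1) − (β+1) z(β+1)|². -/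
lemma kreal (al b s A B R : ℝ) (hal : 1 < al ^ 2) (hs : 1 < s) (hs2 : s ^ 2 = al ^ 2 + b ^ 2)
    (hA : 0 ≤ A) (hB : 0 ≤ B) (hR : R ^ 2 ≤ A * B) :
    4 * R ≤ ((al ^ 2 + (b - 1) ^ 2) * A + (al ^ 2 + (b + 1) ^ 2) * B
      + (2 * s ^ 2 + 2) * R) / s := by
  have h1 : (s - 1) ^ 4 ≤ (al ^ 2 + (b - 1) ^ 2) * (al ^ 2 + (b + 1) ^ 2) := by
    have e : (al ^ 2 + (b - 1) ^ 2) * (al ^ 2 + (b + 1) ^ 2) = (s ^ 2 + 1) ^ 2 - 4 * b ^ 2 := by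
      rw [hs2]; ring
    have : b ^ 2 ≤ s ^ 2 - 1 := by linarith
    have h3 : 0 ≤ s * (s - 1) ^ 2 := by positivity
    rw [e]; nlinarith
  set p := al ^ 2 + (b - 1) ^ 2 with hp
  set q := al ^ 2 + (b + 1) ^ 2 with hq
  have hp0 : 0 ≤ p := by positivity
  have hq0 : 0 ≤ q := by positivity
  have h2 : (R * (s - 1) ^ 2) ^ 2 ≤ ((p * A + q * B) / 2) ^ 2 := by
    calc (R * (s - 1) ^ 2) ^ 2 = R ^ 2 * (s - 1) ^ 4 := by ring
      _ ≤ (A * B) * (p * q) := by gcongr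
      _ ≤ _ := by nlinarith [sq_nonneg (p * A - q * B)]
  have h3 := (abs_le.1 (abs_le_of_sq_le_sq h2 (by positivity))).1
  rw [le_div_iff₀ (by linarith)]
  nlinarith

lemma Sv_sq (α : ℝ) (β : ℤ) : Sv α β ^ 2 = α ^ 2 + (β : ℝ) ^ 2 := by
  unfold Sv; rw [Real.sq_sqrt (by positivity)]

lemma Sv_gt (α : ℝ) (hα : 1 < α ^ 2) (β : ℤ) : 1 < Sv α β := by
  unfold Sv
  rw [Real.lt_sqrt (by norm_num)]
  nlinarith [sq_nonneg (β : ℝ)]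

lemma kpoint (α : ℝ) (hα : 1 < α ^ 2) (β : ℤ) (a b : ℂ) :
    α ^ 2 * ‖a - b‖ ^ 2 + ‖((β - 1 : ℤ) : ℂ) * a - ((β + 1 : ℤ) : ℂ) * b‖ ^ 2 ≤
    ((((Sv α (β - 1) ^ 2 : ℝ) : ℂ) * a - ((Sv α (β + 1) ^ 2 : ℝ) : ℂ) * b) *
          (starRingEnd ℂ) (a - b)).re +
    (((((Sv α (β - 1) ^ 2 : ℝ) : ℂ) * a + ((Sv α (β + 1) ^ 2 : ℝ) : ℂ) * b) /
              ((Sv α β : ℝ) : ℂ)) * (starRingEnd ℂ) (a + b)).re := by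
  have hs := Sv_gt α hα β
  have hs2 := Sv_sq α β
  rw [Sv_sq, Sv_sq]
  set s := Sv α β
  have key := kreal α β s (a.re ^ 2 + a.im ^ 2) (b.re ^ 2 + b.im ^ 2)
    (a.re * b.re + a.im * b.im) hα hs hs2 (by positivity) (by positivity)
    (by nlinarith [sq_nonneg (a.re * b.im - a.im * b.re)])
  have e2 : (((((α ^ 2 + ((β - 1 : ℤ) : ℝ) ^ 2 : ℝ) : ℂ) * a
      + ((α ^ 2 + ((β + 1 : ℤ) : ℝ) ^ 2 : ℝ) : ℂ) * b) / (s : ℂ)) * (starRingEnd ℂ) (a + b)).re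
      = ((α ^ 2 + ((β : ℝ) - 1) ^ 2) * (a.re ^ 2 + a.im ^ 2)
        + (α ^ 2 + ((β : ℝ) + 1) ^ 2) * (b.re ^ 2 + b.im ^ 2)
      + (2 * s ^ 2 + 2) * (a.re * b.re + a.im * b.im)) / s := by
    rw [Complex.mul_re, Complex.div_ofReal_re, Complex.div_ofReal_im, hs2]
    simp only [Complex.add_re, Complex.add_im, Complex.re_ofReal_mul, Complex.im_ofReal_mul,
      Complex.conj_re, Complex.conj_im]
    push_cast
    ring
  have e1 : ((((α ^ 2 + ((β - 1 : ℤ) : ℝ) ^ 2 : ℝ) : ℂ) * a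
      - ((α ^ 2 + ((β + 1 : ℤ) : ℝ) ^ 2 : ℝ) : ℂ) * b) * (starRingEnd ℂ) (a - b)).re
      = α ^ 2 * ‖a - b‖ ^ 2 + ‖((β - 1 : ℤ) : ℂ) * a - ((β + 1 : ℤ) : ℂ) * b‖ ^ 2
        - 4 * (a.re * b.re + a.im * b.im) := by
    have c1 : ((β - 1 : ℤ) : ℂ) = (((β : ℝ) - 1 : ℝ) : ℂ) := by push_cast; rfl
    have c2 : ((β + 1 : ℤ) : ℂ) = (((β : ℝ) + 1 : ℝ) : ℂ) := by push_cast; rfl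
    rw [c1, c2, Complex.sq_norm, Complex.sq_norm, Complex.normSq_apply, Complex.normSq_apply]
    simp only [Complex.mul_re, Complex.sub_re, Complex.sub_im, Complex.re_ofReal_mul,
      Complex.im_ofReal_mul, Complex.conj_re, Complex.conj_im, Complex.ofReal_re,
      Complex.ofReal_im, Complex.mul_im]
    push_cast
    ring
  rw [e1, e2]
  linarith

lemma kbd (p q x y : ℝ) (hp : 0 ≤ p) (hq : 0 ≤ q) (hx : 0 ≤ x) (hy : 0 ≤ y) :
    (p * x + q * y) * (x + y) ≤ 2 * ((p ^ 2 + 1) * x ^ 2 + (q ^ 2 + 1) * y ^ 2) := by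
  nlinarith [sq_nonneg (p * x - x), sq_nonneg (p * x - y), sq_nonneg (q * y - x),
    sq_nonneg (q * y - y), sq_nonneg (p * x), sq_nonneg (q * y), sq_nonneg x, sq_nonneg y]

lemma kbd2 (p q m n : ℝ) (a b : ℂ) (hp : m ^ 2 ≤ p ^ 2 + 1) (hq : n ^ 2 ≤ q ^ 2 + 1) :
    ‖(m : ℂ) * a - (n : ℂ) * b‖ ^ 2 ≤ 2 * ((p ^ 2 + 1) * ‖a‖ ^ 2 + (q ^ 2 + 1) * ‖b‖ ^ 2) := by
  have h : ‖(m : ℂ) * a - (n : ℂ) * b‖ ≤ |m| * ‖a‖ + |n| * ‖b‖ := by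
    refine (norm_sub_le _ _).trans ?_
    simp
  have h1 : m ^ 2 * ‖a‖ ^ 2 ≤ (p ^ 2 + 1) * ‖a‖ ^ 2 := by gcongr
  have h2 : n ^ 2 * ‖b‖ ^ 2 ≤ (q ^ 2 + 1) * ‖b‖ ^ 2 := by gcongr
  calc _ ≤ (|m| * ‖a‖ + |n| * ‖b‖) ^ 2 := by gcongr
    _ ≤ 2 * (|m| ^ 2 * ‖a‖ ^ 2 + |n| ^ 2 * ‖b‖ ^ 2) := by
      nlinarith [sq_nonneg (|m| * ‖a‖ - |n| * ‖b‖)]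
    _ ≤ _ := by rw [sq_abs, sq_abs]; linarith

theorem subcritical_key_inequality (α : ℝ) (hα : 1 < |α|) (z : ℤ → ℂ)
    (hz : RapidlyDecayingSeq z) :
    -(1 / 4) * (∑' β : ℤ,
        (((Sv α (β - 1) ^ 2 : ℝ) : ℂ) * z (β - 1) - ((Sv α (β + 1) ^ 2 : ℝ) : ℂ) * z (β + 1)) *
          (starRingEnd ℂ) (z (β - 1) - z (β + 1))).re
      - (1 / 4) * (∑' β : ℤ,
          ((((Sv α (β - 1) ^ 2 : ℝ) : ℂ) * z (β - 1) + ((Sv α (β + 1) ^ 2 : ℝ) : ℂ) * z (β + 1)) /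
              ((Sv α β : ℝ) : ℂ)) * (starRingEnd ℂ) (z (β - 1) + z (β + 1))).re
      ≤ -(α ^ 2 / 4) * (∑' β : ℤ, ‖z (β - 1) - z (β + 1)‖ ^ 2)
        - (1 / 4) * ∑' β : ℤ, ‖((β - 1 : ℤ) : ℂ) * z (β - 1) - ((β + 1 : ℤ) : ℂ) * z (β + 1)‖ ^ 2 := by
  have hα2 : 1 < α ^ 2 := by rw [← sq_abs]; nlinarith
  have hg : Summable (fun k : ℤ => ((Sv α k ^ 2) ^ 2 + 1) * ‖z k‖ ^ 2) := by
    refine Summable.of_nonneg_of_le (fun k => by positivity) (fun k => ?_)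
      ((hz 2).mul_left ((α ^ 2 + 1) ^ 2 + 1))
    rw [← mul_assoc, Sv_sq]
    have h1 : α ^ 2 + (k : ℝ) ^ 2 ≤ (α ^ 2 + 1) * (1 + (k : ℝ) ^ 2) := by
      nlinarith [mul_nonneg (sq_nonneg α) (sq_nonneg (k : ℝ))]
    have h2 : (α ^ 2 + (k : ℝ) ^ 2) ^ 2 ≤ ((α ^ 2 + 1) * (1 + (k : ℝ) ^ 2)) ^ 2 := by gcongr
    have h3 : (1 : ℝ) ≤ (1 + (k : ℝ) ^ 2) ^ 2 := one_le_pow₀ (by nlinarith [sq_nonneg (k : ℝ)])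
    gcongr
    nlinarith
  have hG : Summable (fun β : ℤ => 2 * (((Sv α (β - 1) ^ 2) ^ 2 + 1) * ‖z (β - 1)‖ ^ 2
      + ((Sv α (β + 1) ^ 2) ^ 2 + 1) * ‖z (β + 1)‖ ^ 2)) := by
    have i1 : Function.Injective (fun β : ℤ => β - 1) := sub_left_injective
    have i2 : Function.Injective (fun β : ℤ => β + 1) := add_left_injective 1
    exact ((hg.comp_injective i1).add (hg.comp_injective i2)).mul_left 2
  have b1 : ∀ (p q : ℝ) (a b : ℂ), 0 ≤ p → 0 ≤ q →
      (‖(p : ℂ) * a‖ + ‖(q : ℂ) * b‖) * (‖a‖ + ‖b‖)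
        ≤ 2 * ((p ^ 2 + 1) * ‖a‖ ^ 2 + (q ^ 2 + 1) * ‖b‖ ^ 2) := by
    intro p q a b hp hq
    rw [norm_mul, norm_mul, Complex.norm_of_nonneg hp, Complex.norm_of_nonneg hq]
    exact kbd p q _ _ hp hq (norm_nonneg _) (norm_nonneg _)
  have s1 : Summable (fun β : ℤ =>
      (((Sv α (β - 1) ^ 2 : ℝ) : ℂ) * z (β - 1) - ((Sv α (β + 1) ^ 2 : ℝ) : ℂ) * z (β + 1)) *
          (starRingEnd ℂ) (z (β - 1) - z (β + 1))) := by
    refine Summable.of_norm_bounded hG (fun β => ?_)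
    refine le_trans ?_ (b1 _ _ _ _ (sq_nonneg _) (sq_nonneg _))
    rw [norm_mul, RCLike.norm_conj]
    gcongr
    · exact norm_sub_le _ _
    · exact norm_sub_le _ _
  have s2 : Summable (fun β : ℤ =>
      ((((Sv α (β - 1) ^ 2 : ℝ) : ℂ) * z (β - 1) + ((Sv α (β + 1) ^ 2 : ℝ) : ℂ) * z (β + 1)) /
              ((Sv α β : ℝ) : ℂ)) * (starRingEnd ℂ) (z (β - 1) + z (β + 1))) := by
    refine Summable.of_norm_bounded hG (fun β => ?_)
    refine le_trans ?_ (b1 _ _ _ _ (sq_nonneg _) (sq_nonneg _))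
    have hs := Sv_gt α hα2 β
    rw [norm_mul, RCLike.norm_conj, norm_div, Complex.norm_of_nonneg (by linarith)]
    gcongr
    · exact (div_le_self (norm_nonneg _) hs.le).trans (norm_add_le _ _)
    · exact norm_add_le _ _
  have s3 : Summable (fun β : ℤ => ‖z (β - 1) - z (β + 1)‖ ^ 2) := by
    refine Summable.of_nonneg_of_le (fun k => by positivity) (fun β => ?_) hG
    have := kbd2 (Sv α (β - 1) ^ 2) (Sv α (β + 1) ^ 2) 1 1 (z (β - 1)) (z (β + 1))
      (by nlinarith [sq_nonneg (Sv α (β - 1) ^ 2)]) (by nlinarith [sq_nonneg (Sv α (β + 1) ^ 2)])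
    simpa using this
  have s4 : Summable (fun β : ℤ =>
      ‖((β - 1 : ℤ) : ℂ) * z (β - 1) - ((β + 1 : ℤ) : ℂ) * z (β + 1)‖ ^ 2) := by
    refine Summable.of_nonneg_of_le (fun k => by positivity) (fun β => ?_) hG
    have hk : ∀ k : ℤ, (k : ℝ) ^ 2 ≤ (Sv α k ^ 2) ^ 2 + 1 := by
      intro k
      have := Sv_sq α k
      nlinarith [sq_nonneg (Sv α k ^ 2 - 1)]
    have := kbd2 (Sv α (β - 1) ^ 2) (Sv α (β + 1) ^ 2) ((β - 1 : ℤ) : ℝ) ((β + 1 : ℤ) : ℝ)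
      (z (β - 1)) (z (β + 1)) (hk _) (hk _)
    rwa [Complex.ofReal_intCast, Complex.ofReal_intCast] at this
  have r1 := Complex.hasSum_re s1.hasSum
  have r2 := Complex.hasSum_re s2.hasSum
  have := hasSum_le (fun β => kpoint α hα2 β (z (β - 1)) (z (β + 1)))
    ((s3.hasSum.mul_left (α ^ 2)).add s4.hasSum) (r1.add r2)
  linarith
end
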